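/- arXiv:1204.5378 — 2 statements merged into one kernel-verified Lean document; each statement's English description precedes it below -/
import Mathlib

section
/- Let n ≥ 2 be an integer. Let c_1, …, c_{n−1} be the standard basis of the free abelian group Z^{n−1}, set c_0 = −(c_1 + ⋯ + c_{n−1}), and extend n-periodically by c_i = c_{i mod n} for all i ∈ Z. For integers i, j define c_{i,j} = c_{i−1} + c_{i−2} + ⋯ + c_{j'}, where j' is the largest integer with j' ≤ i and j' ≡ j (mod n) (an empty sum, equal to 0, when j' = i). Then for any integers i_1, …, i_n the following are equivalent: (1) modulo n the multiset {i_1, …, i_n} coincides with {1, …, n} (i.e., the residues of i_1, …, i_n are pairwise distinct); (2) c_{i_1} + c_{i_2} + ⋯ + c_{i_n} = 0; (3) c_{i_1,1} + c_{i_2,2} + ⋯ + c_{i_n,n} = 0. -/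
/-- `c_i` as a vector in `ℤ^{n-1}`: for `i ≢ 0 (mod n)` with residue `r ∈ {1,…,n-1}`
it is the standard basis vector `c_r = e_r`; for `i ≡ 0` it is
`c_0 = -(c_1 + ⋯ + c_{n-1}) = (-1, …, -1)`.  (Basis vector `c_r` is coordinate `r - 1`.) -/
def cvec (n : ℕ) (i : ℤ) : Fin (n - 1) → ℤ := fun j =>
  if (i : ZMod n) = (((j : ℕ) + 1 : ℕ) : ZMod n) then 1
  else if (i : ZMod n) = 0 then -1 else 0

/-- `c_{i,j} = c_{i-1} + c_{i-2} + ⋯ + c_{j'}`, where `j'` is the largest integer with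
`j' ≤ i` and `j' ≡ j (mod n)` (the empty sum when `j' = i`). -/
def csum (n : ℕ) (i j : ℤ) : Fin (n - 1) → ℤ :=
  ∑ t ∈ Finset.range ((i - j).emod n).toNat, cvec n (i - 1 - (t : ℤ))

def indz (n : ℕ) (x r : ZMod n) : ℤ := if x = r then 1 else 0

lemma cvec_eq (n : ℕ) (i : ℤ) (j : Fin (n - 1)) :
    cvec n i j = indz n i (((j : ℕ) + 1 : ℕ) : ZMod n) - indz n i 0 := by
  have hj := j.2
  have h0 : (((j : ℕ) + 1 : ℕ) : ZMod n) ≠ 0 := by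
    intro h
    rw [ZMod.natCast_eq_zero_iff] at h
    have := Nat.le_of_dvd (by omega) h
    omega
  unfold cvec indz
  by_cases h1 : (i : ZMod n) = (((j : ℕ) + 1 : ℕ) : ZMod n)
  · rw [if_pos h1, if_pos h1, if_neg (by rw [h1]; exact h0)]; rfl
  · rw [if_neg h1, if_neg h1]
    split_ifs <;> rfl

lemma const_iff (n : ℕ) (hn : 2 ≤ n) (F : ZMod n → ℤ) :
    (∀ j : Fin (n - 1), F (((j : ℕ) + 1 : ℕ) : ZMod n) - F 0 = 0) ↔ ∀ r, F r = F 0 := by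
  haveI : NeZero n := ⟨by omega⟩
  constructor
  · intro h r
    have hr := ZMod.val_lt r
    have hv := ZMod.natCast_zmod_val r
    by_cases h0 : r.val = 0
    · rw [h0] at hv
      rw [← hv]; simp
    · have := h ⟨r.val - 1, by omega⟩
      have e : r.val - 1 + 1 = r.val := by omega
      simp only [e, hv] at this
      linarith
  · intro h j
    rw [h]; simp

lemma const_iff_shift (n : ℕ) (hn : 2 ≤ n) (F : ZMod n → ℤ) :
    (∀ r, F r = F 0) ↔ ∀ r, F r - F (r - 1) = 0 := by
  haveI : NeZero n := ⟨by omega⟩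
  constructor
  · intro h r
    rw [h r, h (r - 1)]; simp
  · intro h r
    have key : ∀ k : ℕ, F (k : ZMod n) = F 0 := by
      intro k
      induction k with
      | zero => simp
      | succ k ih =>
        have := h ((k + 1 : ℕ) : ZMod n)
        have e : ((k + 1 : ℕ) : ZMod n) - 1 = k := by push_cast; ring
        rw [e] at this
        linarith
    rw [← ZMod.natCast_zmod_val r]
    exact key _

lemma sum_ind_bij (n : ℕ) (f : Fin n → ZMod n) (hf : Function.Bijective f) (r : ZMod n) :
    ∑ m, indz n (f m) r = 1 := by
  obtain ⟨m0, hm0⟩ := hf.2 r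
  rw [Finset.sum_eq_single m0]
  · simp [indz, hm0]
  · intro b _ hb
    unfold indz
    rw [if_neg]
    intro h
    exact hb (hf.1 (h.trans hm0.symm))
  · simp

lemma inj_bij (n : ℕ) (hn : 2 ≤ n) (f : Fin n → ZMod n) (h : Function.Injective f) :
    Function.Bijective f := by
  haveI : NeZero n := ⟨by omega⟩
  exact (Fintype.bijective_iff_injective_and_card f).2 ⟨h, by simp [ZMod.card]⟩

lemma inj_iff (n : ℕ) (hn : 2 ≤ n) (f : Fin n → ZMod n) :
    Function.Injective f ↔ ∀ r, ∑ m, indz n (f m) r = 1 := by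
  haveI : NeZero n := ⟨by omega⟩
  constructor
  · intro h r
    exact sum_ind_bij n f (inj_bij n hn f h) r
  · intro h
    have hs : Function.Surjective f := by
      intro r
      by_contra hc
      push Not at hc
      have := h r
      rw [Finset.sum_eq_zero] at this
      · simp at this
      · intro m _
        simp [indz, hc m]
    exact ((Fintype.bijective_iff_surjective_and_card f).2 ⟨hs, by simp [ZMod.card]⟩).1

lemma cnt_const (n : ℕ) (hn : 2 ≤ n) (f : Fin n → ZMod n) :
    (∀ r, ∑ m, indz n (f m) r = ∑ m, indz n (f m) 0) ↔ ∀ r, ∑ m, indz n (f m) r = 1 := by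
  haveI : NeZero n := ⟨by omega⟩
  constructor
  · intro h
    have tot : ∑ r, ∑ m, indz n (f m) r = n := by
      rw [Finset.sum_comm]
      simp [indz]
    rw [Finset.sum_congr rfl (fun r _ => h r)] at tot
    simp only [Finset.sum_const, Finset.card_univ, ZMod.card, nsmul_eq_mul] at tot
    have hn0 : (n : ℤ) ≠ 0 := by positivity
    have : ∑ m, indz n (f m) 0 = 1 := mul_left_cancel₀ hn0 (by rw [tot, mul_one])
    intro r
    rw [h r, this]
  · intro h r
    rw [h, h]

lemma tele (n : ℕ) (x r : ZMod n) (k : ℕ) :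
    ∑ t ∈ Finset.range k, indz n (x - 1 - t) r - ∑ t ∈ Finset.range k, indz n (x - 1 - t) (r - 1)
      = indz n (x - k) r - indz n x r := by
  induction k with
  | zero => simp
  | succ k ih =>
    rw [Finset.sum_range_succ, Finset.sum_range_succ]
    have e1 : indz n (x - 1 - k) (r - 1) = indz n (x - k) r := by
      unfold indz
      congr 1
      rw [eq_iff_iff]
      constructor
      · intro h; linear_combination h
      · intro h; linear_combination h
    have e2 : x - ((k + 1 : ℕ) : ZMod n) = x - 1 - k := by push_cast; ring
    rw [e1, e2]
    linarith

lemma shift_bij (n : ℕ) (hn : 2 ≤ n) :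
    Function.Injective (fun m : Fin n => (((m : ℕ) + 1 : ℕ) : ZMod n)) := by
  intro x y h
  have h' : ((x : ℕ) : ZMod n) = ((y : ℕ) : ZMod n) := by
    have : (((x : ℕ) + 1 : ℕ) : ZMod n) = (((y : ℕ) + 1 : ℕ) : ZMod n) := h
    push_cast at this
    exact add_right_cancel this
  rw [ZMod.natCast_eq_natCast_iff'] at h'
  rw [Nat.mod_eq_of_lt x.2, Nat.mod_eq_of_lt y.2] at h'
  exact Fin.ext h'

lemma emod_cast (n : ℕ) (hn : 2 ≤ n) (i j : ℤ) :
    (i : ZMod n) - ((((i - j).emod n).toNat : ℕ) : ZMod n) = (j : ZMod n) := by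
  have h0 : 0 ≤ (i - j).emod n := Int.emod_nonneg _ (by omega)
  have h1 : ((((i - j).emod n).toNat : ℕ) : ZMod n) = (((i - j) % (n : ℤ) : ℤ) : ZMod n) := by
    rw [← Int.cast_natCast, Int.toNat_of_nonneg h0]; rfl
  rw [h1, ZMod.intCast_mod]
  push_cast
  ring

theorem stmt0 (n : ℕ) (hn : 2 ≤ n) (a : Fin n → ℤ) :
    List.TFAE [
      Function.Injective (fun m : Fin n => ((a m : ZMod n))),
      ∑ m : Fin n, cvec n (a m) = 0,
      ∑ m : Fin n, csum n (a m) ((m : ℕ) + 1) = 0] := by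
  have h12 : Function.Injective (fun m : Fin n => ((a m : ZMod n))) ↔
      ∑ m : Fin n, cvec n (a m) = 0 := by
    rw [inj_iff n hn, ← cnt_const n hn,
      ← const_iff n hn (fun r => ∑ m, indz n ((a m : ℤ) : ZMod n) r), funext_iff]
    refine forall_congr' fun j => ?_
    simp only [Finset.sum_apply, cvec_eq, Finset.sum_sub_distrib, Pi.zero_apply]
  have h13 : Function.Injective (fun m : Fin n => ((a m : ZMod n))) ↔
      ∑ m : Fin n, csum n (a m) ((m : ℕ) + 1) = 0 := by
    let G : ZMod n → ℤ := fun r => ∑ m : Fin n,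
      ∑ t ∈ Finset.range ((a m - (((m : ℕ) : ℤ) + 1)).emod n).toNat,
        indz n ((a m : ZMod n) - 1 - (t : ZMod n)) r
    have hG : (∑ m : Fin n, csum n (a m) ((m : ℕ) + 1) = 0) ↔ ∀ r, G r = G 0 := by
      rw [← const_iff n hn G, funext_iff]
      refine forall_congr' fun j => ?_
      simp only [G, csum, Finset.sum_apply, cvec_eq, Finset.sum_sub_distrib, Pi.zero_apply,
        Int.cast_sub, Int.cast_one, Int.cast_natCast]
    rw [hG, const_iff_shift n hn, inj_iff n hn]
    refine forall_congr' fun r => ?_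
    have hd : G r - G (r - 1) = 1 - ∑ m, indz n ((a m : ℤ) : ZMod n) r := by
      simp only [G]
      rw [← Finset.sum_sub_distrib]
      simp only [tele, emod_cast n hn]
      rw [Finset.sum_sub_distrib]
      have := sum_ind_bij n _ (inj_bij n hn _ (shift_bij n hn)) r
      push_cast at this ⊢
      rw [this]
    rw [hd]
    constructor <;> intro h <;> linarith
  tfae_have 1 ↔ 2 := h12
  tfae_have 1 ↔ 3 := h13
  tfae_finish
end

section
/- Let n ≥ 3 and let C be the n×n matrix with rows and columns indexed by Z/nZ given by C_{ii} = 2, C_{i,i+1} = C_{i,i−1} = −1 (indices modulo n), and C_{ij} = 0 otherwise (the Cartan matrix of type A^{(1)}_{n−1}). Fix k ∈ Z/nZ and let c ∈ Z^n be the standard basis vector with c_i = δ_{i,k}. If b ∈ Z^n satisfies c − Cb ∈ Z_{≥0}^n (componentwise), then all entries of b are equal: b_i = a for some a ∈ Z and all i. -/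
theorem stmt4 (n : ℕ) [NeZero n] (hn : 3 ≤ n) (k : ZMod n) (b : ZMod n → ℤ)
    (h : ∀ i : ZMod n,
      0 ≤ (if i = k then (1 : ℤ) else 0) -
        ∑ j : ZMod n, (if i = j then 2 else if j = i + 1 ∨ j = i - 1 then -1 else 0) * b j) :
    ∃ a : ℤ, ∀ i, b i = a := by
  have cast_ne : ∀ m : ℕ, 0 < m → m < n → (m : ZMod n) ≠ 0 := by
    intro m h0 h1 h2
    rw [ZMod.natCast_eq_zero_iff] at h2
    exact absurd (Nat.le_of_dvd h0 h2) (by omega)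
  have h1 : (1 : ZMod n) ≠ 0 := by simpa using cast_ne 1 (by omega) (by omega)
  have h2 : (2 : ZMod n) ≠ 0 := by simpa using cast_ne 2 (by omega) (by omega)
  have key : ∀ i : ZMod n, ∑ j : ZMod n,
      (if i = j then (2 : ℤ) else if j = i + 1 ∨ j = i - 1 then -1 else 0) * b j
      = 2 * b i - b (i + 1) - b (i - 1) := by
    intro i
    have : ∀ j : ZMod n,
      (if i = j then (2 : ℤ) else if j = i + 1 ∨ j = i - 1 then -1 else 0) * b j
      = (if j = i then 2 * b j else 0) - (if j = i + 1 then b j else 0)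
        - (if j = i - 1 then b j else 0) := by
      intro j
      have e1 : i ≠ i + 1 := fun e => h1 (by linear_combination -e)
      have e2 : i ≠ i - 1 := fun e => h1 (by linear_combination e)
      have e3 : i + 1 ≠ i - 1 := fun e => h2 (by linear_combination e)
      by_cases a1 : j = i
      · subst a1; simp [e1, e2]
      · by_cases a2 : j = i + 1
        · subst a2; simp [e1, e3, h1]
        · by_cases a3 : j = i - 1
          · subst a3; simp [e2, e3.symm, h1]
          · simp [a1, a2, a3, Ne.symm a1]
    simp [this, Finset.sum_sub_distrib]
  simp only [key] at h
  set d : ZMod n → ℤ := fun i => b (i + 1) - b i with hd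
  have hsum : ∑ i, d i = 0 := by
    simp only [hd, Finset.sum_sub_distrib]
    rw [sub_eq_zero]
    exact Equiv.sum_comp (Equiv.addRight (1 : ZMod n)) b
  have step : ∀ i, i + 1 ≠ k → d i ≤ d (i + 1) := by
    intro i hi
    have := h (i + 1)
    simp only [hi, if_false, add_sub_cancel_right] at this
    simp only [hd]; linarith
  have stepk : d (k - 1) ≤ d k + 1 := by
    have := h k
    simp only [if_true] at this
    simp only [hd, sub_add_cancel]; linarith
  have mono : ∀ t s : ℕ, t + s < n → d (k + t) ≤ d (k + (t + s : ℕ)) := by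
    intro t s
    induction s with
    | zero => intro _; simp
    | succ s ih =>
      intro hs
      refine (ih (by omega)).trans ?_
      have e : k + ((t + (s + 1) : ℕ) : ZMod n) = k + ((t + s : ℕ) : ZMod n) + 1 := by
        push_cast; ring
      rw [e]
      apply step
      rw [← e]
      intro e'
      exact cast_ne (t + (s + 1)) (by omega) hs (by linear_combination e')
  have rep : ∀ i : ZMod n, ∃ t : ℕ, t < n ∧ i = k + t := fun i =>
    ⟨(i - k).val, ZMod.val_lt _, by simp⟩
  have lo : ∀ i, d k ≤ d i := by
    intro i
    obtain ⟨t, ht, rfl⟩ := rep i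
    simpa using mono 0 t (by omega)
  have hi : ∀ i, d i ≤ d k + 1 := by
    intro i
    obtain ⟨t, ht, rfl⟩ := rep i
    refine (mono t (n - 1 - t) (by omega)).trans ?_
    have e : t + (n - 1 - t) = n - 1 := by omega
    rw [e, Nat.cast_sub (by omega)]
    simpa [← sub_eq_add_neg] using stepk
  have D0 : 0 ≤ d k := by
    by_contra hneg
    have : ∑ i, d i < ∑ i : ZMod n, (0 : ℤ) :=
      Finset.sum_lt_sum (fun i _ => by have := hi i; omega) ⟨k, Finset.mem_univ _, by omega⟩
    simp [hsum] at this
  have dz : ∀ i, d i = 0 := by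
    intro i
    exact (Finset.sum_eq_zero_iff_of_nonneg (fun i _ => D0.trans (lo i))).1 hsum i
      (Finset.mem_univ _)
  refine ⟨b k, fun i => ?_⟩
  obtain ⟨t, -, rfl⟩ := rep i
  induction t with
  | zero => simp
  | succ t ih =>
    have := dz (k + t)
    simp only [hd] at this
    rw [← ih, Nat.cast_succ, ← add_assoc]
    linarith
end
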